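/- Let k ≥ 1 be an integer, let n = 16k + 1 and s = n − 8. Then HOP(2^⟨s⟩, 4, 6, 6) has a solution, i.e., HOP(2^⟨s⟩, 2m_1, 2m_2, 2m_3) has a solution with (m_1, m_2, m_3) = (2, 3, 3). (In the paper this is stated as: 4K_n^• admits an HOP (C_2, C_3, C_3)-decomposition, which by the paper's Theorem 3.2 is equivalent to the stated HOP solution.) -/

import Mathlib

/-- The vertex set of the complete graph `K_{2n}`: the `n` couples are indexed by `Fin n`,
and the two members of a couple by `Fin 2`. -/
abbrev HOPVertex (n : ℕ) : Type := Fin n × Fin 2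

/-- The spouse of a participant: the other member of the same couple. -/
def HOPspouse {n : ℕ} (v : HOPVertex n) : HOPVertex n := (v.1, v.2 + 1)

/-- An edge of `K_{2n}` is an `I`-edge (an edge of the distinguished perfect matching `I`)
if it joins a participant to their spouse. -/
def IsIEdge {n : ℕ} (e : Sym2 (HOPVertex n)) : Prop :=
  ∃ v, e = s(v, HOPspouse v)

/-- An `I`-alternating `(K_2^⟨s⟩, C_{2m_1}, …, C_{2m_t})`-factor of `K_{2n}`:
a spanning subgraph of `K_{2n}` which is a vertex-disjoint union of `s` edges of `I`
(one for each `a : Fin s`, namely the edge joining `pair a` to its spouse) together with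
`t` cycles, the `i`-th of which has length `2 * m i` (given by the cyclic vertex sequence
`cyc i : ZMod (2 * m i) → HOPVertex n`), such that along each cycle the edges alternate
between `I`-edges (at even positions) and non-`I`-edges (at odd positions).
The field `spanning` says that the listed vertices are pairwise distinct and exhaust the
whole vertex set; in particular each `cyc i` is injective, so it really traces a cycle. -/
structure HOPFactor (n s t : ℕ) (m : Fin t → ℕ) : Type where
  pair : Fin s → HOPVertex n
  cyc : (i : Fin t) → ZMod (2 * m i) → HOPVertex n
  alt_even : ∀ (i : Fin t) (j : ZMod (2 * m i)),
      j.val % 2 = 0 → cyc i (j + 1) = HOPspouse (cyc i j)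
  alt_odd : ∀ (i : Fin t) (j : ZMod (2 * m i)),
      j.val % 2 = 1 → ¬ IsIEdge s(cyc i j, cyc i (j + 1))
  spanning : Function.Bijective
      (Sum.elim
        (fun a : Fin s × Fin 2 => if a.2 = 0 then pair a.1 else HOPspouse (pair a.1))
        (fun x : (i : Fin t) × ZMod (2 * m i) => cyc x.1 x.2))

/-- The edge set of an `I`-alternating `(K_2^⟨s⟩, C_{2m_1}, …, C_{2m_t})`-factor. -/
def HOPFactor.edges {n s t : ℕ} {m : Fin t → ℕ} (F : HOPFactor n s t m) :
    Set (Sym2 (HOPVertex n)) :=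
  {e | (∃ a : Fin s, e = s(F.pair a, HOPspouse (F.pair a))) ∨
    ∃ (i : Fin t) (j : ZMod (2 * m i)), e = s(F.cyc i j, F.cyc i (j + 1))}

/-- A solution to the generalized Honeymoon Oberwolfach Problem
`HOP(2^⟨s⟩, 2 m_1, …, 2 m_t)`: a family of `γ` `I`-alternating
`(K_2^⟨s⟩, C_{2m_1}, …, C_{2m_t})`-factors of `K_{2n}`, where `γ` is the natural number
with `γ * (m_1 + ⋯ + m_t) = 2n(n-1)`, such that every edge of `K_{2n}` that is not an
`I`-edge lies in exactly one factor of the family. -/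
def HOPSolution (n s t : ℕ) (m : Fin t → ℕ) : Prop :=
  ∃ γ : ℕ, γ * (∑ i, m i) = 2 * n * (n - 1) ∧
    ∃ F : Fin γ → HOPFactor n s t m,
      ∀ e : Sym2 (HOPVertex n), ¬ e.IsDiag → ¬ IsIEdge e →
        ∃! k : Fin γ, e ∈ (F k).edges

/-- The successor of a position among the eight couples (one 2-cycle, two 3-cycles). -/
def hopNext : Fin 8 → Fin 8 := ![1, 0, 3, 4, 2, 6, 7, 5]

/-- The eight non-spouse edges determined by the eight entry vertices. -/
def hopSlot {n : ℕ} (q : Fin 8 → HOPVertex n) (l : Fin 8) : Sym2 (HOPVertex n) :=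
  s(HOPspouse (q l), q (hopNext l))

/-- The vertices of the cycles, as a function of the position. -/
def hopCyc {n : ℕ} (q : Fin 8 → HOPVertex n) : (i : Fin 3) → ZMod (2 * (![2, 3, 3] i)) → HOPVertex n
  | 0 => (![q 0, HOPspouse (q 0), q 1, HOPspouse (q 1)] : Fin 4 → HOPVertex n)
  | 1 => (![q 2, HOPspouse (q 2), q 3, HOPspouse (q 3), q 4, HOPspouse (q 4)] :
      Fin 6 → HOPVertex n)
  | 2 => (![q 5, HOPspouse (q 5), q 6, HOPspouse (q 6), q 7, HOPspouse (q 7)] :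
      Fin 6 → HOPVertex n)

theorem hop_not_I {n : ℕ} {a b : HOPVertex n} (h : a.1 ≠ b.1) : ¬ IsIEdge s(a, b) := by
  rintro ⟨v, hv⟩
  rw [Sym2.eq_iff] at hv
  rcases hv with ⟨rfl, rfl⟩ | ⟨rfl, rfl⟩ <;> simp [HOPspouse] at h

theorem hop_spouse_spouse {n : ℕ} (v : HOPVertex n) : HOPspouse (HOPspouse v) = v := by
  obtain ⟨a, x⟩ := v
  fin_cases x <;> simp [HOPspouse]

theorem hop_eq_or {n : ℕ} {v w : HOPVertex n} (h : v.1 = w.1) : v = w ∨ v = HOPspouse w := by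
  obtain ⟨a, x⟩ := v
  obtain ⟨b, y⟩ := w
  simp only at h
  subst h
  fin_cases x <;> fin_cases y <;> simp [HOPspouse]

theorem hop_factor {n s : ℕ} (hs : s + 8 = n) (q : Fin 8 → HOPVertex n)
    (hq : Function.Injective fun l => (q l).1) :
    ∃ F : HOPFactor n s 3 ![2, 3, 3],
      ∀ e, ¬ IsIEdge e → (e ∈ F.edges ↔ ∃ l, e = hopSlot q l) := by
  classical
  let S : Finset (Fin n) := (Finset.univ.image fun l => (q l).1)ᶜ
  have hS : S.card = s := by
    rw [Finset.card_compl, Finset.card_image_of_injective _ hq]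
    simp; omega
  let f : Fin s ≃ S := (S.equivFinOfCardEq hS).symm
  have hne : ∀ l l', l ≠ l' → (q l).1 ≠ (q l').1 := fun l l' h h' => h (hq h')
  refine ⟨⟨fun a => ((f a : Fin n), 0), hopCyc q, ?_, ?_, ?_⟩, ?_⟩
  · intro i
    fin_cases i
    · intro (j : Fin 4)
      fin_cases j <;> intro h <;> first | rfl | exact absurd h (by decide)
    · intro (j : Fin 6)
      fin_cases j <;> intro h <;> first | rfl | exact absurd h (by decide)
    · intro (j : Fin 6)
      fin_cases j <;> intro h <;> first | rfl | exact absurd h (by decide)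
  · intro i
    fin_cases i
    · intro (j : Fin 4)
      fin_cases j <;> intro h <;> first
        | exact absurd h (by decide)
        | exact hop_not_I (hne 0 1 (by decide))
        | exact hop_not_I (hne 1 0 (by decide))
    · intro (j : Fin 6)
      fin_cases j <;> intro h <;> first
        | exact absurd h (by decide)
        | exact hop_not_I (hne 2 3 (by decide))
        | exact hop_not_I (hne 3 4 (by decide))
        | exact hop_not_I (hne 4 2 (by decide))
    · intro (j : Fin 6)
      fin_cases j <;> intro h <;> first
        | exact absurd h (by decide)
        | exact hop_not_I (hne 5 6 (by decide))
        | exact hop_not_I (hne 6 7 (by decide))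
        | exact hop_not_I (hne 7 5 (by decide))
  · have : ∀ i : Fin 3, NeZero (2 * (![2, 3, 3] i)) := by
      intro i; fin_cases i <;> exact ⟨by decide⟩
    rw [Fintype.bijective_iff_surjective_and_card]
    constructor
    · intro v
      by_cases hv : v.1 ∈ S
      · have hf : f (f.symm ⟨v.1, hv⟩) = ⟨v.1, hv⟩ := f.apply_symm_apply _
        refine ⟨Sum.inl (f.symm ⟨v.1, hv⟩, v.2), ?_⟩
        obtain ⟨a, x⟩ := v
        fin_cases x <;> simp [HOPspouse, hf]
      · have : ∃ l, (q l).1 = v.1 := by simpa [S] using hv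
        obtain ⟨l, hl⟩ := this
        have key : ∃ (i : Fin 3) (j : ZMod (2 * (![2, 3, 3] i))), hopCyc q i j = v := by
          rcases hop_eq_or hl.symm with rfl | rfl
          · fin_cases l
            · exact ⟨0, (0 : Fin 4), rfl⟩
            · exact ⟨0, (2 : Fin 4), rfl⟩
            · exact ⟨1, (0 : Fin 6), rfl⟩
            · exact ⟨1, (2 : Fin 6), rfl⟩
            · exact ⟨1, (4 : Fin 6), rfl⟩
            · exact ⟨2, (0 : Fin 6), rfl⟩
            · exact ⟨2, (2 : Fin 6), rfl⟩
            · exact ⟨2, (4 : Fin 6), rfl⟩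
          · fin_cases l
            · exact ⟨0, (1 : Fin 4), rfl⟩
            · exact ⟨0, (3 : Fin 4), rfl⟩
            · exact ⟨1, (1 : Fin 6), rfl⟩
            · exact ⟨1, (3 : Fin 6), rfl⟩
            · exact ⟨1, (5 : Fin 6), rfl⟩
            · exact ⟨2, (1 : Fin 6), rfl⟩
            · exact ⟨2, (3 : Fin 6), rfl⟩
            · exact ⟨2, (5 : Fin 6), rfl⟩
        obtain ⟨i, j, h⟩ := key
        exact ⟨Sum.inr ⟨i, j⟩, h⟩
    · simp only [Fintype.card_sum, Fintype.card_prod, Fintype.card_sigma, ZMod.card,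
        Fintype.card_fin, Fin.sum_univ_three]
      simp
      omega
  · intro e he
    constructor
    · rintro (⟨a, rfl⟩ | ⟨i, j, rfl⟩)
      · exact absurd ⟨_, rfl⟩ he
      · revert j
        fin_cases i
        · intro (j : Fin 4)
          fin_cases j <;> intro he
          · exact absurd ⟨_, rfl⟩ he
          · exact ⟨0, rfl⟩
          · exact absurd ⟨_, rfl⟩ he
          · exact ⟨1, rfl⟩
        · intro (j : Fin 6)
          fin_cases j <;> intro he
          · exact absurd ⟨_, rfl⟩ he
          · exact ⟨2, rfl⟩
          · exact absurd ⟨_, rfl⟩ he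
          · exact ⟨3, rfl⟩
          · exact absurd ⟨_, rfl⟩ he
          · exact ⟨4, rfl⟩
        · intro (j : Fin 6)
          fin_cases j <;> intro he
          · exact absurd ⟨_, rfl⟩ he
          · exact ⟨5, rfl⟩
          · exact absurd ⟨_, rfl⟩ he
          · exact ⟨6, rfl⟩
          · exact absurd ⟨_, rfl⟩ he
          · exact ⟨7, rfl⟩
    · rintro ⟨l, rfl⟩
      right
      fin_cases l
      · exact ⟨0, (1 : Fin 4), rfl⟩
      · exact ⟨0, (3 : Fin 4), rfl⟩
      · exact ⟨1, (1 : Fin 6), rfl⟩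
      · exact ⟨1, (3 : Fin 6), rfl⟩
      · exact ⟨1, (5 : Fin 6), rfl⟩
      · exact ⟨2, (1 : Fin 6), rfl⟩
      · exact ⟨2, (3 : Fin 6), rfl⟩
      · exact ⟨2, (5 : Fin 6), rfl⟩

/-- A covering family of the right size is a solution (uniqueness follows by counting). -/
theorem hop_of_cover {n s : ℕ} (hs : s + 8 = n) {ι : Type} [Fintype ι]
    (hcard : Fintype.card ι * 8 = 2 * n * (n - 1))
    (q : ι → Fin 8 → HOPVertex n) (hq : ∀ i, Function.Injective fun l => (q i l).1)
    (hcov : ∀ a b : HOPVertex n, a.1 ≠ b.1 → ∃ i l, s(a, b) = hopSlot (q i) l) :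
    HOPSolution n s 3 ![2, 3, 3] := by
  classical
  have hcov' : ∀ e : Sym2 (HOPVertex n), ¬ e.IsDiag → ¬ IsIEdge e →
      ∃ i l, e = hopSlot (q i) l := by
    intro e
    induction e using Sym2.ind with
    | _ a b =>
      intro hd hI
      apply hcov
      intro hab
      rcases hop_eq_or hab with rfl | rfl
      · exact hd rfl
      · exact hI ⟨HOPspouse b, by rw [hop_spouse_spouse]⟩
  let Φ : ι × Fin 8 → Sym2 (HOPVertex n) := fun x => hopSlot (q x.1) x.2
  have hΦ : Function.Injective Φ := by
    let D : Finset (Sym2 (HOPVertex n)) := Finset.univ.filter fun e => ¬ e.IsDiag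
    let J : Finset (Sym2 (HOPVertex n)) :=
      Finset.univ.image fun a : Fin n => s(((a, 0) : HOPVertex n), (a, 1))
    have hD : D.card = (2 * n).choose 2 := by
      have := Sym2.card_subtype_not_diag (α := HOPVertex n)
      rw [Fintype.card_subtype] at this
      rw [show 2 * n = Fintype.card (HOPVertex n) by simp [mul_comm], ← this]
    have hJ : J.card ≤ n := Finset.card_image_le.trans (by simp)
    have hsub : D \ J ⊆ Finset.univ.image Φ := by
      intro e he
      simp only [D, J, Finset.mem_sdiff, Finset.mem_filter, Finset.mem_univ, true_and,
        Finset.mem_image, not_exists] at he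
      obtain ⟨i, l, h⟩ := hcov' e he.1 (by
        rintro ⟨⟨a, x⟩, rfl⟩
        apply he.2 a
        fin_cases x
        · rfl
        · exact Sym2.eq_swap)
      simp only [Finset.mem_image, Finset.mem_univ, true_and]
      exact ⟨(i, l), h.symm⟩
    have h1 := Finset.card_le_card hsub
    have h2 := Finset.le_card_sdiff J D
    have h3 : (2 * n).choose 2 = 2 * n * (n - 1) + n := by
      rw [Nat.choose_two_right]
      obtain ⟨m, rfl⟩ : ∃ m, n = m + 1 := ⟨n - 1, by omega⟩
      apply Nat.div_eq_of_eq_mul_left (by norm_num)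
      have : 2 * (m + 1) - 1 = 2 * m + 1 := by omega
      rw [this, Nat.add_sub_cancel]
      ring
    have h4 : (Finset.univ.image Φ).card = (Finset.univ : Finset (ι × Fin 8)).card := by
      apply le_antisymm Finset.card_image_le
      rw [Finset.card_univ, Fintype.card_prod, Fintype.card_fin, hcard]
      omega
    have h5 := Finset.card_image_iff.1 h4
    intro x y h
    exact h5 (by simp) (by simp) h
  choose F hF using fun i => hop_factor hs (q i) (hq i)
  let σ := (Fintype.equivFin ι).symm
  refine ⟨Fintype.card ι, ?_, fun k => F (σ k), ?_⟩
  · rw [← hcard]; simp [Fin.sum_univ_three]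
  · intro e hd hI
    obtain ⟨i, l, h⟩ := hcov' e hd hI
    refine ⟨σ.symm i, ?_, ?_⟩
    · simp only [Equiv.apply_symm_apply]
      exact (hF i e hI).2 ⟨l, h⟩
    · intro k hk
      obtain ⟨l', h'⟩ := (hF (σ k) e hI).1 hk
      have : (σ k, l') = (i, l) := hΦ (h'.symm.trans h)
      have hki : σ k = i := (Prod.ext_iff.1 this).1
      rw [← hki]
      simp

/-- Residue class of a natural number in `Fin (16 * k + 1)`. -/
def hopC (k m : ℕ) : Fin (16 * k + 1) := Fin.ofNat (16 * k + 1) m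

theorem hopC_add (k a b : ℕ) : hopC k (a + b) = hopC k a + hopC k b := by
  apply Fin.ext
  simp [hopC, Fin.val_add]

theorem hopC_ne {k a b : ℕ} (ha : a < 16 * k + 1) (hb : b < 16 * k + 1) (h : a ≠ b) :
    hopC k a ≠ hopC k b := by
  intro h'
  have := congrArg Fin.val h'
  simp only [hopC, Fin.val_ofNat, Nat.mod_eq_of_lt ha, Nat.mod_eq_of_lt hb] at this
  exact h this

theorem hop_diff {k : ℕ} (a b : Fin (16 * k + 1)) (h : a ≠ b) :
    ∃ d, 1 ≤ d ∧ d ≤ 8 * k ∧ (b = a + hopC k d ∨ a = b + hopC k d) := by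
  have key : ∀ a b : Fin (16 * k + 1), a < b →
      ∃ d, 1 ≤ d ∧ d ≤ 8 * k ∧ (b = a + hopC k d ∨ a = b + hopC k d) := by
    intro a b hab
    have hab' : a.val < b.val := hab
    have hb := b.isLt
    by_cases hd : b.val - a.val ≤ 8 * k
    · refine ⟨b.val - a.val, by omega, hd, Or.inl (Fin.ext ?_)⟩
      simp only [hopC, Fin.val_add, Fin.val_ofNat, Nat.add_mod_mod]
      rw [show a.val + (b.val - a.val) = b.val by omega, Nat.mod_eq_of_lt hb]
    · refine ⟨16 * k + 1 - (b.val - a.val), by omega, by omega, Or.inr (Fin.ext ?_)⟩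
      simp only [hopC, Fin.val_add, Fin.val_ofNat, Nat.add_mod_mod]
      rw [show b.val + (16 * k + 1 - (b.val - a.val)) = a.val + (16 * k + 1) by omega,
        Nat.add_mod_right, Nat.mod_eq_of_lt (by omega)]
  rcases lt_or_gt_of_ne h with h | h
  · exact key a b h
  · obtain ⟨d, h1, h2, h3⟩ := key b a h
    exact ⟨d, h1, h2, h3.symm⟩

/-- A translate of `B` disjoint from `A`. -/
theorem hop_translate {N : ℕ} [NeZero N] {p r : ℕ} (h : p * r < N) (A : Fin p → Fin N)
    (B : Fin r → Fin N) : ∃ t : Fin N, ∀ i j, A i ≠ t + B j := by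
  classical
  by_contra hcon
  push Not at hcon
  have hsub : (Finset.univ : Finset (Fin N)) ⊆
      Finset.univ.image fun x : Fin p × Fin r => A x.1 - B x.2 := by
    intro t _
    obtain ⟨i, j, hij⟩ := hcon t
    simp only [Finset.mem_image, Finset.mem_univ, true_and]
    exact ⟨(i, j), by rw [hij]; simp⟩
  have := (Finset.card_le_card hsub).trans Finset.card_image_le
  simp at this
  omega

/-- The leftover differences. -/
def hopL (k i : ℕ) : ℕ := if i = 0 then 5 * k + 1 else 6 * k + 1 + i

/-- The entry vertices of the factors. -/
def hopQ (k : ℕ) (u t : Fin (16 * k + 1)) (j : ℕ) (α β : Fin 2) (g : Fin (16 * k + 1)) :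
    Fin 8 → HOPVertex (16 * k + 1) :=
  ![(g + (t + hopC k 0), 0), (g + (t + hopC k (hopL k (2 * j + α.val))), β),
    (g + hopC k 0, α), (g + hopC k (2 * j + 1), β), (g + hopC k (3 * k + 1 + j), α + β),
    (g + (u + hopC k 0), α), (g + (u + hopC k (2 * j + 2)), β),
    (g + (u + hopC k (5 * k + 2 + j)), α + β)]

theorem hop_inj8 {X : Type} {x0 x1 x2 x3 x4 x5 x6 x7 : X}
    (h01 : x0 ≠ x1) (h02 : x0 ≠ x2) (h03 : x0 ≠ x3) (h04 : x0 ≠ x4) (h05 : x0 ≠ x5) (h06 : x0 ≠ x6) (h07 : x0 ≠ x7)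
    (h12 : x1 ≠ x2) (h13 : x1 ≠ x3) (h14 : x1 ≠ x4) (h15 : x1 ≠ x5) (h16 : x1 ≠ x6) (h17 : x1 ≠ x7)
    (h23 : x2 ≠ x3) (h24 : x2 ≠ x4) (h25 : x2 ≠ x5) (h26 : x2 ≠ x6) (h27 : x2 ≠ x7)
    (h34 : x3 ≠ x4) (h35 : x3 ≠ x5) (h36 : x3 ≠ x6) (h37 : x3 ≠ x7)
    (h45 : x4 ≠ x5) (h46 : x4 ≠ x6) (h47 : x4 ≠ x7)
    (h56 : x5 ≠ x6) (h57 : x5 ≠ x7)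
    (h67 : x6 ≠ x7)
    : Function.Injective ![x0, x1, x2, x3, x4, x5, x6, x7] := by
  intro l l' h
  fin_cases l <;> fin_cases l' <;> first
    | rfl
    | (exfalso; simp at h; simp_all)

theorem hopL_bounds (k i : ℕ) (h : i < 2 * k) : 0 < hopL k i ∧ hopL k i ≤ 8 * k := by
  unfold hopL
  split_ifs <;> omega

theorem hop_exists_shift (k j : ℕ) (hj : j < k) (α : Fin 2) :
    ∃ u t, ∀ β g, Function.Injective fun l => (hopQ k u t j α β g l).1 := by
  have hL := hopL_bounds k (2 * j + α.val) (by omega)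
  obtain ⟨u, hu⟩ := hop_translate (N := 16 * k + 1) (p := 3) (r := 3) (by omega)
    ![hopC k 0, hopC k (2 * j + 1), hopC k (3 * k + 1 + j)]
    ![hopC k 0, hopC k (2 * j + 2), hopC k (5 * k + 2 + j)]
  obtain ⟨t, ht⟩ := hop_translate (N := 16 * k + 1) (p := 6) (r := 2) (by omega)
    ![hopC k 0, hopC k (2 * j + 1), hopC k (3 * k + 1 + j),
      u + hopC k 0, u + hopC k (2 * j + 2), u + hopC k (5 * k + 2 + j)]
    ![hopC k 0, hopC k (hopL k (2 * j + α.val))]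
  refine ⟨u, t, fun β g => ?_⟩
  have e : ∀ {a b : ℕ}, a < b → b ≤ 8 * k → hopC k a ≠ hopC k b := fun h h' =>
    hopC_ne (by omega) (by omega) (by omega)
  have e' : ∀ {a b : ℕ} (w : Fin (16 * k + 1)), a < b → b ≤ 8 * k →
      w + hopC k a ≠ w + hopC k b := fun w h h' h'' => e h h' (add_left_cancel h'')
  have R : Function.Injective ![t + hopC k 0, t + hopC k (hopL k (2 * j + α.val)),
      hopC k 0, hopC k (2 * j + 1), hopC k (3 * k + 1 + j),
      u + hopC k 0, u + hopC k (2 * j + 2), u + hopC k (5 * k + 2 + j)] :=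
    hop_inj8 (e' t (by omega) (by omega))
      (ht 0 0).symm (ht 1 0).symm (ht 2 0).symm (ht 3 0).symm (ht 4 0).symm (ht 5 0).symm
      (ht 0 1).symm (ht 1 1).symm (ht 2 1).symm (ht 3 1).symm (ht 4 1).symm (ht 5 1).symm
      (e (by omega) (by omega)) (e (by omega) (by omega)) (hu 0 0) (hu 0 1) (hu 0 2)
      (e (by omega) (by omega)) (hu 1 0) (hu 1 1) (hu 1 2)
      (hu 2 0) (hu 2 1) (hu 2 2)
      (e' u (by omega) (by omega)) (e' u (by omega) (by omega)) (e' u (by omega) (by omega))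
  have hR : (fun l => (hopQ k u t j α β g l).1) = fun l => g +
      (![t + hopC k 0, t + hopC k (hopL k (2 * j + α.val)),
      hopC k 0, hopC k (2 * j + 1), hopC k (3 * k + 1 + j),
      u + hopC k 0, u + hopC k (2 * j + 2), u + hopC k (5 * k + 2 + j)] :
        Fin 8 → Fin (16 * k + 1)) l := by
    funext l
    fin_cases l <;> rfl
  rw [hR]
  exact (add_right_injective g).comp R

/-- Every difference occurs in one of the triples or is a leftover. -/
theorem hop_classify (k d : ℕ) (h1 : 1 ≤ d) (h2 : d ≤ 8 * k) :
    ∃ j, j < k ∧ (d = 2 * j + 1 ∨ 2 * j + 1 + d = 3 * k + 1 + j ∨ d = 3 * k + 1 + j ∨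
      d = 2 * j + 2 ∨ 2 * j + 2 + d = 5 * k + 2 + j ∨ d = 5 * k + 2 + j ∨
      ∃ α : Fin 2, d = hopL k (2 * j + α.val)) := by
  by_cases a1 : d ≤ 2 * k
  · refine ⟨(d - 1) / 2, by omega, by omega⟩
  by_cases a2 : d ≤ 3 * k
  · exact ⟨3 * k - d, by omega, by omega⟩
  by_cases a3 : d ≤ 4 * k
  · exact ⟨d - (3 * k + 1), by omega, by omega⟩
  by_cases a4 : d ≤ 5 * k
  · exact ⟨5 * k - d, by omega, by omega⟩
  by_cases a5 : d = 5 * k + 1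
  · refine ⟨0, by omega, ?_⟩
    iterate 6 right
    exact ⟨0, by simp [hopL, a5]⟩
  by_cases a6 : d ≤ 6 * k + 1
  · exact ⟨d - (5 * k + 2), by omega, by omega⟩
  · refine ⟨(d - (6 * k + 1)) / 2, by omega, ?_⟩
    iterate 6 right
    refine ⟨⟨(d - (6 * k + 1)) % 2, by omega⟩, ?_⟩
    unfold hopL
    simp only
    split_ifs <;> omega

theorem hop_fin2 (p : Fin 2) : p + 1 + 1 = p := by fin_cases p <;> rfl

theorem hop_fin2' (p r : Fin 2) : p + r + r = p := by fin_cases p <;> fin_cases r <;> rfl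

theorem hop_fin2'' (p r : Fin 2) : p + (r + p) = r := by fin_cases p <;> fin_cases r <;> rfl

theorem hop_cover (k : ℕ) (u t : ℕ → Fin 2 → Fin (16 * k + 1)) (a b : Fin (16 * k + 1))
    (p r : Fin 2) (d : ℕ) (h1 : 1 ≤ d) (h2 : d ≤ 8 * k) (hb : b = a + hopC k d) :
    ∃ j, j < k ∧ ∃ (α β : Fin 2) (g : Fin (16 * k + 1)) (l : Fin 8),
      s((a, p), (b, r)) = hopSlot (hopQ k (u j α) (t j α) j α β g) l := by
  have c0 : hopC k 0 = 0 := rfl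
  obtain ⟨j, hj, h⟩ := hop_classify k d h1 h2
  refine ⟨j, hj, ?_⟩
  have S : ∀ (v w v' w' : HOPVertex (16 * k + 1)), v = v' → w = w' → s(v, w) = s(v', w') := by
    rintro v w _ _ rfl rfl; rfl
  have S' : ∀ (v w v' w' : HOPVertex (16 * k + 1)), v = w' → w = v' → s(v, w) = s(v', w') := by
    rintro v w _ _ rfl rfl; exact Sym2.eq_swap
  rcases h with h | h | h | h | h | h | ⟨α, h⟩
  · refine ⟨p + 1, r, a, 2, S _ _ _ _ (Prod.ext ?_ ?_) (Prod.ext ?_ ?_)⟩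
    · change a = a + hopC k 0
      simp [c0]
    · exact (hop_fin2 p).symm
    · rw [hb, h]; rfl
    · rfl
  · refine ⟨r + (p + 1), p + 1, a - hopC k (2 * j + 1), 3,
      S _ _ _ _ (Prod.ext ?_ ?_) (Prod.ext ?_ ?_)⟩
    · change a = a - hopC k (2 * j + 1) + hopC k (2 * j + 1)
      simp
    · exact (hop_fin2 p).symm
    · change b = a - hopC k (2 * j + 1) + hopC k (3 * k + 1 + j)
      rw [hb, ← h, hopC_add k _ d]; abel
    · exact (hop_fin2' r (p + 1)).symm
  · refine ⟨p, r + 1 + p, a, 4, S' _ _ _ _ (Prod.ext ?_ ?_) (Prod.ext ?_ ?_)⟩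
    · change a = a + hopC k 0
      simp [c0]
    · rfl
    · rw [hb, h]; rfl
    · change r = p + (r + 1 + p) + 1
      rw [hop_fin2'', hop_fin2]
  · refine ⟨p + 1, r, a - u j (p + 1), 5, S _ _ _ _ (Prod.ext ?_ ?_) (Prod.ext ?_ ?_)⟩
    · change a = a - u j (p + 1) + (u j (p + 1) + hopC k 0)
      simp [c0]
    · exact (hop_fin2 p).symm
    · change b = a - u j (p + 1) + (u j (p + 1) + hopC k (2 * j + 2))
      rw [hb, h]; abel
    · rfl
  · refine ⟨r + (p + 1), p + 1, a - hopC k (2 * j + 2) - u j (r + (p + 1)), 6,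
      S _ _ _ _ (Prod.ext ?_ ?_) (Prod.ext ?_ ?_)⟩
    · change a = a - hopC k (2 * j + 2) - u j (r + (p + 1)) +
        (u j (r + (p + 1)) + hopC k (2 * j + 2))
      abel
    · exact (hop_fin2 p).symm
    · change b = a - hopC k (2 * j + 2) - u j (r + (p + 1)) +
        (u j (r + (p + 1)) + hopC k (5 * k + 2 + j))
      rw [hb, ← h, hopC_add k _ d]; abel
    · exact (hop_fin2' r (p + 1)).symm
  · refine ⟨p, r + 1 + p, a - u j p, 7, S' _ _ _ _ (Prod.ext ?_ ?_) (Prod.ext ?_ ?_)⟩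
    · change a = a - u j p + (u j p + hopC k 0)
      simp [c0]
    · rfl
    · change b = a - u j p + (u j p + hopC k (5 * k + 2 + j))
      rw [hb, h]; abel
    · change r = p + (r + 1 + p) + 1
      rw [hop_fin2'', hop_fin2]
  · have hp : p = 0 ∨ p = 1 := by fin_cases p <;> simp
    rcases hp with rfl | rfl
    · refine ⟨α, r + 1, a - t j α, 1, S' _ _ _ _ (Prod.ext ?_ ?_) (Prod.ext ?_ ?_)⟩
      · change a = a - t j α + (t j α + hopC k 0)
        simp [c0]
      · rfl
      · change b = a - t j α + (t j α + hopC k (hopL k (2 * j + α.val)))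
        rw [hb, h]; abel
      · exact (hop_fin2 r).symm
    · refine ⟨α, r, a - t j α, 0, S _ _ _ _ (Prod.ext ?_ ?_) (Prod.ext ?_ ?_)⟩
      · change a = a - t j α + (t j α + hopC k 0)
        simp [c0]
      · rfl
      · change b = a - t j α + (t j α + hopC k (hopL k (2 * j + α.val)))
        rw [hb, h]; abel
      · rfl

/-- Lemma 6.5: for `k ≥ 1`, `n = 16k + 1` and `s = n - 8`,
`HOP(2^⟨s⟩, 4, 6, 6)` has a solution. -/
theorem hop_C2_C3_C3 (k n s : ℕ) (hk : 1 ≤ k) (hn : n = 16 * k + 1)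
    (hs : s = n - 8) :
    HOPSolution n s 3 ![2, 3, 3] := by
  subst hn
  have H : ∀ (j : ℕ) (α : Fin 2), ∃ u t : Fin (16 * k + 1), j < k → ∀ β g,
      Function.Injective fun l => (hopQ k u t j α β g l).1 := by
    intro j α
    by_cases hj : j < k
    · obtain ⟨u, t, h⟩ := hop_exists_shift k j hj α
      exact ⟨u, t, fun _ => h⟩
    · exact ⟨0, 0, fun h => absurd h hj⟩
  choose u t hut using H
  refine hop_of_cover (ι := (Fin k × Fin 2 × Fin 2) × Fin (16 * k + 1)) (by omega) ?_
    (fun i => hopQ k (u i.1.1.val i.1.2.1) (t i.1.1.val i.1.2.1) i.1.1.val i.1.2.1 i.1.2.2 i.2)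
    (fun i => hut _ _ i.1.1.isLt _ _) ?_
  · simp only [Fintype.card_prod, Fintype.card_fin, Nat.add_sub_cancel]
    ring
  · rintro ⟨a, p⟩ ⟨b, r⟩ hab
    obtain ⟨d, h1, h2, h | h⟩ := hop_diff a b hab
    · obtain ⟨j, hj, α, β, g, l, hl⟩ := hop_cover k u t a b p r d h1 h2 h
      exact ⟨((⟨j, hj⟩, α, β), g), l, hl⟩
    · obtain ⟨j, hj, α, β, g, l, hl⟩ := hop_cover k u t b a r p d h1 h2 h
      exact ⟨((⟨j, hj⟩, α, β), g), l, Sym2.eq_swap.trans hl⟩
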